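/- arXiv:math/0106150 — 4 statements merged into one kernel-verified Lean document; each statement's English description precedes it below -/
import Mathlib

section
/- Let A be a unital associative ℂ-algebra, q ∈ ℂ a unit (q ≠ 0), n = 2p with p ≥ 1, and let S₁, …, S_n ∈ A be invertible elements satisfying S_i·S_{i+1} = q·(S_{i+1}·S_i) for i = 1, …, n−1 and S_i·S_j = S_j·S_i whenever |i−j| ≥ 2. Define U_j := S₁·S₃·⋯·S_{2j−1} and V_j := S_{2j} for j = 1, …, p. Then U_j·V_j = q·(V_j·U_j) for every j, U_j·V_k = V_k·U_j for all j ≠ k, U_j·U_k = U_k·U_j for all j, k, and V_j·V_k = V_k·V_j for all j, k. Moreover, if there is an additional invertible element S_{2p+1} satisfying the same relations (S_{2p}·S_{2p+1} = q·(S_{2p+1}·S_{2p}) and S_i·S_{2p+1} = S_{2p+1}·S_i for i ≤ 2p−1), then Z := S₁·S₃·⋯·S_{2p+1} commutes with every S_i, i = 1, …, 2p+1. -/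
/-- The product `S₁S₃⋯S_{2j-1}` of the first `j` odd-indexed terms. -/
def oddProd {A : Type*} [Monoid A] (S : ℕ → A) (j : ℕ) : A :=
  ((List.range j).map (fun i => S (2 * i + 1))).prod

theorem oddProd_succ {A : Type*} [Monoid A] (S : ℕ → A) (j : ℕ) :
    oddProd S (j + 1) = oddProd S j * S (2 * j + 1) := by
  simp [oddProd, List.range_succ]

theorem commute_oddProd {A : Type*} [Monoid A] {S : ℕ → A} {j : ℕ} {a : A}
    (h : ∀ i < j, Commute (S (2 * i + 1)) a) : Commute (oddProd S j) a := by
  induction j with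
  | zero => simp [oddProd]
  | succ j ih =>
    rw [oddProd_succ]
    exact (ih fun i hi => h i (by omega)).mul_left (h j (by omega))

/-- The relations of a chain `S₁, …, S_N` in which neighbours `q`-commute and all other pairs
commute. -/
structure IsQChain {K A : Type*} [Mul A] [SMul K A] (q : K) (N : ℕ) (S : ℕ → A) : Prop where
  rel : ∀ i, 1 ≤ i → i + 1 ≤ N → S i * S (i + 1) = q • (S (i + 1) * S i)
  comm : ∀ i j, 1 ≤ i → i + 2 ≤ j → j ≤ N → Commute (S i) (S j)

namespace IsQChain

section Monoid

variable {K A : Type*} [Monoid A] [SMul K A] {q : K} {N : ℕ} {S : ℕ → A}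

theorem commute_of_ne (h : IsQChain q N S) {i j : ℕ} (hi : 1 ≤ i) (hiN : i ≤ N) (hj : 1 ≤ j)
    (hjN : j ≤ N) (h₁ : i + 1 ≠ j) (h₂ : j + 1 ≠ i) : Commute (S i) (S j) := by
  rcases lt_trichotomy i j with hij | rfl | hij
  · exact h.comm i j hi (by omega) hjN
  · exact Commute.refl _
  · exact (h.comm j i hj (by omega) hiN).symm

theorem commute_oddProd_odd (h : IsQChain q N S) {j k : ℕ} (hj : 2 * j ≤ N + 1)
    (hk : 2 * k + 1 ≤ N) : Commute (oddProd S j) (S (2 * k + 1)) :=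
  commute_oddProd fun i hi =>
    h.commute_of_ne (by omega) (by omega) (by omega) hk (by omega) (by omega)

theorem commute_oddProd_oddProd (h : IsQChain q N S) {j k : ℕ} (hj : 2 * j ≤ N + 1)
    (hk : 2 * k ≤ N + 1) : Commute (oddProd S j) (oddProd S k) :=
  (commute_oddProd fun i hi => (h.commute_oddProd_odd hj (by omega)).symm).symm

theorem commute_oddProd_even_of_lt (h : IsQChain q N S) {j k : ℕ} (hjk : j < k)
    (hk : 2 * k ≤ N) : Commute (oddProd S j) (S (2 * k)) :=
  commute_oddProd fun i hi =>
    h.commute_of_ne (by omega) (by omega) (by omega) hk (by omega) (by omega)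

end Monoid

section Algebra

variable {K A : Type*} [Field K] [Ring A] [Algebra K A] {q : K} {N : ℕ} {S : ℕ → A}

theorem oddProd_mul_even (h : IsQChain q N S) {k : ℕ} (hk : 1 ≤ k) (hkN : 2 * k ≤ N) :
    oddProd S k * S (2 * k) = q • (S (2 * k) * oddProd S k) := by
  obtain ⟨k, rfl⟩ := Nat.exists_eq_add_of_le' hk
  have hr := h.rel (2 * k + 1) (by omega) (by omega)
  have hc := (h.commute_oddProd_even_of_lt (Nat.lt_succ_self k) hkN).eq
  rw [show 2 * k + 1 + 1 = 2 * (k + 1) by ring] at hr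
  rw [oddProd_succ, mul_assoc, hr, mul_smul_comm, ← mul_assoc, hc, mul_assoc]

theorem commute_oddProd_even_of_gt (h : IsQChain q N S) (hq : q ≠ 0) {j k : ℕ} (hk : 1 ≤ k)
    (hkj : k < j) (hj : 2 * j ≤ N + 1) : Commute (oddProd S j) (S (2 * k)) := by
  induction j, hkj using Nat.le_induction with
  | base =>
    have hr : S (2 * k + 1) * S (2 * k) = q⁻¹ • (S (2 * k) * S (2 * k + 1)) := by
      rw [h.rel (2 * k) (by omega) (by omega), inv_smul_smul₀ hq]
    rw [commute_iff_eq, oddProd_succ, mul_assoc, hr, mul_smul_comm, ← mul_assoc,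
      h.oddProd_mul_even hk (by omega), smul_mul_assoc, inv_smul_smul₀ hq, mul_assoc]
  | succ j hkj ih =>
    rw [oddProd_succ]
    exact (ih (by omega)).mul_left
      (h.commute_of_ne (by omega) (by omega) (by omega) (by omega) (by omega) (by omega))

end Algebra

end IsQChain


/-- Generators of a higher-dimensional noncommutative torus regroup into
`p` commuting copies of noncommutative 2-tori; with one more generator, the odd product
`Z = S₁S₃⋯S_{2p+1}` is central. -/
theorem stmt2 {A : Type*} [Ring A] [Algebra ℂ A] (q : ℂ) (hq : q ≠ 0)
    (p : ℕ) (hp : 1 ≤ p) (n : ℕ) (hn : n = 2 * p)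
    (S : ℕ → A)
    (hinv : ∀ i, 1 ≤ i → i ≤ n → IsUnit (S i))
    (hrel : ∀ i, 1 ≤ i → i + 1 ≤ n → S i * S (i + 1) = q • (S (i + 1) * S i))
    (hcomm : ∀ i j, 1 ≤ i → i ≤ n → 1 ≤ j → j ≤ n → i + 2 ≤ j → S i * S j = S j * S i)
    (U V : ℕ → A)
    (hU : ∀ j, U j = ((List.range j).map (fun i => S (2 * i + 1))).prod)
    (hV : ∀ j, V j = S (2 * j)) :
    (∀ j, 1 ≤ j → j ≤ p → U j * V j = q • (V j * U j)) ∧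
    (∀ j k, 1 ≤ j → j ≤ p → 1 ≤ k → k ≤ p → j ≠ k → U j * V k = V k * U j) ∧
    (∀ j k, 1 ≤ j → j ≤ p → 1 ≤ k → k ≤ p → U j * U k = U k * U j) ∧
    (∀ j k, 1 ≤ j → j ≤ p → 1 ≤ k → k ≤ p → V j * V k = V k * V j) ∧
    (IsUnit (S (2 * p + 1)) →
      S (2 * p) * S (2 * p + 1) = q • (S (2 * p + 1) * S (2 * p)) →
      (∀ i, 1 ≤ i → i ≤ 2 * p - 1 → S i * S (2 * p + 1) = S (2 * p + 1) * S i) →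
      ∀ i, 1 ≤ i → i ≤ 2 * p + 1 →
        ((List.range (p + 1)).map (fun k => S (2 * k + 1))).prod * S i =
          S i * ((List.range (p + 1)).map (fun k => S (2 * k + 1))).prod) := by
  have h : IsQChain q (2 * p) S :=
    ⟨fun i h₁ h₂ => hrel i h₁ (by omega),
      fun i j h₁ h₂ h₃ => hcomm i j h₁ (by omega) (by omega) (by omega) h₂⟩
  replace hU : ∀ j, U j = oddProd S j := hU
  simp only [hU, hV]
  refine ⟨fun j h₁ h₂ => h.oddProd_mul_even h₁ (by omega), fun j k hj₁ hj₂ hk₁ hk₂ hjk => ?_,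
    fun j k _ hj _ hk => h.commute_oddProd_oddProd (by omega) (by omega),
    fun j k _ _ _ _ => h.commute_of_ne (by omega) (by omega) (by omega) (by omega) (by omega)
      (by omega),
    fun _ hr hc i hi₁ hi₂ => ?_⟩
  · rcases hjk.lt_or_gt with hjk | hjk
    · exact h.commute_oddProd_even_of_lt hjk (by omega)
    · exact h.commute_oddProd_even_of_gt hq hk₁ hjk (by omega)
  · have h' : IsQChain q (2 * p + 1) S := by
      refine ⟨fun i h₁ h₂ => ?_, fun i j h₁ h₂ h₃ => ?_⟩
      · obtain h₂ | rfl : i + 1 ≤ 2 * p ∨ i = 2 * p := by omega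
        · exact h.rel i h₁ h₂
        · exact hr
      · obtain h₃ | rfl : j ≤ 2 * p ∨ j = 2 * p + 1 := by omega
        · exact h.comm i j h₁ h₂ h₃
        · exact hc i h₁ (by omega)
    change Commute (oddProd S (p + 1)) (S i)
    obtain ⟨k, rfl | rfl⟩ := Nat.even_or_odd' i
    · exact h'.commute_oddProd_even_of_gt hq (by omega) (by omega) (by omega)
    · exact h'.commute_oddProd_odd (by omega) hi₂
end

section
/- Let A be a unital associative ℂ-algebra, let ℏ ∈ ℝ, and let Q, P ∈ A satisfy the Heisenberg relation Q·P − P·Q = (iℏ)·1. Then for all m, n ∈ ℕ one has Q^n·P^m = Σ_{k=0}^{min(m,n)} (n choose k)·(m choose k)·k!·(iℏ)^k·P^{m−k}·Q^{n−k}. -/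
/-- If `Q * P - P * Q = c • 1`, then `Q` acts on powers of `P` as `c` times a derivation. -/
theorem mul_pow_of_commutator_eq_smul_one {R A : Type*} [CommRing R] [Ring A] [Algebra R A]
    {c : R} {Q P : A} (h : Q * P - P * Q = c • (1 : A)) (m : ℕ) :
    Q * P ^ m = P ^ m * Q + ((m : R) * c) • P ^ (m - 1) := by
  have hQP : Q * P = P * Q + c • (1 : A) := by rw [← h]; abel
  induction m with
  | zero => simp
  | succ m ih =>
    have hm : ((m : R) * c) • (P ^ (m - 1) * P) = ((m : R) * c) • P ^ m := by
      cases m with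
      | zero => simp
      | succ m => rw [Nat.add_sub_cancel, ← pow_succ]
    rw [pow_succ, ← mul_assoc, ih, add_mul, mul_assoc, hQP, smul_mul_assoc, hm, mul_add,
      mul_smul_comm, mul_one, Nat.add_sub_cancel, ← mul_assoc, add_assoc, ← add_smul]
    congr 2
    push_cast
    ring

/-- Normal ordering of `Q ^ n * P ^ m` when `Q * P - P * Q = c • 1`, summed over `k ≤ n`. -/
theorem pow_mul_pow_of_commutator_eq_smul_one {R A : Type*} [CommRing R] [Ring A] [Algebra R A]
    {c : R} {Q P : A} (h : Q * P - P * Q = c • (1 : A)) (m n : ℕ) :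
    Q ^ n * P ^ m = ∑ k ∈ Finset.range (n + 1),
      ((n.choose k : R) * (m.choose k : R) * (k.factorial : R) * c ^ k) •
        (P ^ (m - k) * Q ^ (n - k)) := by
  induction n with
  | zero => simp
  | succ n ih =>
    have hstep : ∀ k ∈ Finset.range (n + 1),
        Q * (((n.choose k : R) * (m.choose k : R) * (k.factorial : R) * c ^ k) •
          (P ^ (m - k) * Q ^ (n - k))) =
        ((n.choose k : R) * (m.choose k : R) * (k.factorial : R) * c ^ k) •
          (P ^ (m - k) * Q ^ (n + 1 - k)) +
        ((n.choose k : R) * (m.choose (k + 1) : R) * ((k + 1).factorial : R) * c ^ (k + 1)) •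
          (P ^ (m - (k + 1)) * Q ^ (n + 1 - (k + 1))) := by
      intro k hk
      have hkn : n + 1 - k = n - k + 1 := by
        have := Finset.mem_range.mp hk
        omega
      have hchoose : (m.choose (k + 1) : R) * ((k : R) + 1) =
          (m.choose k : R) * ((m - k : ℕ) : R) := by
        exact_mod_cast congrArg (Nat.cast : ℕ → R) (Nat.choose_succ_right_eq m k)
      rw [mul_smul_comm, ← mul_assoc Q, mul_pow_of_commutator_eq_smul_one h, add_mul, mul_assoc _ Q,
        ← pow_succ', ← hkn, smul_add, smul_mul_assoc, smul_smul, Nat.sub_sub, Nat.add_sub_add_right]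
      congr 2
      rw [Nat.factorial_succ]
      push_cast
      linear_combination (-(n.choose k : R) * (k.factorial : R) * c ^ (k + 1)) * hchoose
    have hpascal : ∀ k ∈ Finset.range (n + 1),
        (((n + 1).choose (k + 1) : R) * (m.choose (k + 1) : R) * ((k + 1).factorial : R) *
          c ^ (k + 1)) • (P ^ (m - (k + 1)) * Q ^ (n + 1 - (k + 1))) =
        ((n.choose (k + 1) : R) * (m.choose (k + 1) : R) * ((k + 1).factorial : R) *
          c ^ (k + 1)) • (P ^ (m - (k + 1)) * Q ^ (n + 1 - (k + 1))) +
        ((n.choose k : R) * (m.choose (k + 1) : R) * ((k + 1).factorial : R) * c ^ (k + 1)) •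
          (P ^ (m - (k + 1)) * Q ^ (n + 1 - (k + 1))) := by
      intro k _
      rw [← add_smul, Nat.choose_succ_succ]
      congr 1
      push_cast
      ring
    have hshift := Finset.sum_range_succ' (fun k ↦
      ((n.choose k : R) * (m.choose k : R) * (k.factorial : R) * c ^ k) •
        (P ^ (m - k) * Q ^ (n + 1 - k))) (n + 1)
    rw [Finset.sum_range_succ] at hshift
    simp only [Nat.choose_succ_self, Nat.cast_zero, zero_mul, zero_smul, add_zero] at hshift
    rw [pow_succ', mul_assoc, ih, Finset.mul_sum, Finset.sum_congr rfl hstep,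
      Finset.sum_add_distrib, hshift, Finset.sum_range_succ' _ (n + 1), Finset.sum_congr rfl hpascal,
      Finset.sum_add_distrib]
    simp only [Nat.choose_zero_right]
    abel


open Finset in
/-- If `Q, P` in a unital associative ℂ-algebra satisfy the Heisenberg
relation `QP - PQ = iℏ·1`, then
`Qⁿ Pᵐ = Σ_{k=0}^{min(m,n)} (n choose k)(m choose k) k! (iℏ)ᵏ P^{m-k} Q^{n-k}`. -/
theorem stmt3 {A : Type*} [Ring A] [Algebra ℂ A] (ℏ : ℝ) (Q P : A)
    (h : Q * P - P * Q = (Complex.I * (ℏ : ℂ)) • (1 : A)) :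
    ∀ m n : ℕ, Q ^ n * P ^ m =
      ∑ k ∈ Finset.range (min m n + 1),
        ((n.choose k : ℂ) * (m.choose k : ℂ) * (Nat.factorial k : ℂ) *
          (Complex.I * (ℏ : ℂ)) ^ k) • (P ^ (m - k) * Q ^ (n - k)) := by
  intro m n
  rw [pow_mul_pow_of_commutator_eq_smul_one h m n]
  symm
  apply Finset.sum_subset
  · intro k hk
    simp only [Finset.mem_range] at hk ⊢
    omega
  · intro k hk hk'
    simp only [Finset.mem_range] at hk hk'
    rw [Nat.choose_eq_zero_of_lt (show m < k by omega)]
    simp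
end

section
/- Let ℏ ∈ ℝ. For a ∈ 𝓢(ℝ², ℂ) define the twisted convolution (a ∗_ℏ b)(t, s) := ∫_{ℝ²} a(t−u, s−v)·b(u, v)·e^{i(s−v)uℏ} du dv for b ∈ 𝓢(ℝ², ℂ), and define the operator Op_ℏ(a) on functions f : ℝ → ℂ by (Op_ℏ(a)f)(u) := ∫_{ℝ²} a(t, s)·e^{itu}·f(u + sℏ) dt ds. Then for all a, b ∈ 𝓢(ℝ², ℂ), all f ∈ 𝓢(ℝ, ℂ), and all u ∈ ℝ, one has (Op_ℏ(a ∗_ℏ b)f)(u) = (Op_ℏ(a)(Op_ℏ(b)f))(u); i.e. Op_ℏ is an algebra homomorphism from the twisted convolution to composition of operators. -/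
open MeasureTheory

/-- Fubini for a twisted convolution integrand, combined with the shear `p ↦ p + q`. -/
theorem integral_integral_sub_mul_eq_shear {a b : ℝ × ℝ → ℂ} (ha : Integrable a)
    (hb : Integrable b) {φ : (ℝ × ℝ) × (ℝ × ℝ) → ℂ} (hφ : Continuous φ) {C : ℝ}
    (hC : ∀ z, ‖φ z‖ ≤ C) :
    ∫ p : ℝ × ℝ, ∫ q : ℝ × ℝ, a (p - q) * b q * φ (p, q) =
      ∫ p : ℝ × ℝ, ∫ q : ℝ × ℝ, a p * b q * φ (p + q, q) := by
  have hsub : Integrable (fun z : (ℝ × ℝ) × (ℝ × ℝ) => a (z.1 - z.2) * b z.2 * φ z)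
      (volume.prod volume) := by
    refine Integrable.mul_bdd ?_ hφ.aestronglyMeasurable (.of_forall hC)
    simpa [mul_comm] using hb.convolution_integrand (ContinuousLinearMap.mul ℝ ℂ) ha
  have hadd : Integrable
      (fun z : (ℝ × ℝ) × (ℝ × ℝ) => a z.1 * b z.2 * φ (z.1 + z.2, z.2))
      (volume.prod volume) :=
    (ha.mul_prod hb).mul_bdd
      (hφ.comp (by fun_prop : Continuous fun z : (ℝ × ℝ) × (ℝ × ℝ) =>
        (z.1 + z.2, z.2))).aestronglyMeasurable
      (.of_forall fun _ => hC _)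
  refine (integral_integral_swap hsub).trans (Eq.trans ?_ (integral_integral_swap hadd).symm)
  refine integral_congr_ae (.of_forall fun q => ?_)
  simpa using (integral_add_right_eq_self (fun p => a (p - q) * b q * φ (p, q)) q).symm

/-- The operator `(Op_ℏ(a)f)(u) = ∫ a(t,s) e^{itu} f(u+sℏ) dt ds` is an
algebra homomorphism from the twisted convolution
`(a ∗_ℏ b)(t,s) = ∫ a(t-u, s-v) b(u,v) e^{i(s-v)uℏ} du dv`
to composition of operators, pointwise on Schwartz functions. -/
theorem stmt9 (ℏ : ℝ)
    (conv : ((ℝ × ℝ) → ℂ) → ((ℝ × ℝ) → ℂ) → ((ℝ × ℝ) → ℂ))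
    (hconv : ∀ (a b : (ℝ × ℝ) → ℂ) (t s : ℝ),
      conv a b (t, s) = ∫ p : ℝ × ℝ, a (t - p.1, s - p.2) * b p *
        Complex.exp (Complex.I * ((s - p.2 : ℝ) : ℂ) * (p.1 : ℂ) * (ℏ : ℂ)))
    (Op : ((ℝ × ℝ) → ℂ) → (ℝ → ℂ) → (ℝ → ℂ))
    (hOp : ∀ (a : (ℝ × ℝ) → ℂ) (f : ℝ → ℂ) (u : ℝ),
      Op a f u = ∫ p : ℝ × ℝ, a p * Complex.exp (Complex.I * (p.1 : ℂ) * (u : ℂ)) *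
        f (u + p.2 * ℏ)) :
    ∀ (a b : SchwartzMap (ℝ × ℝ) ℂ) (f : SchwartzMap ℝ ℂ) (u : ℝ),
      Op (conv ⇑a ⇑b) (⇑f) u = Op (⇑a) (Op (⇑b) ⇑f) u := by
  intro a b f u
  let φ : (ℝ × ℝ) × (ℝ × ℝ) → ℂ := fun z =>
    Complex.exp (((z.1.2 - z.2.2) * z.2.1 * ℏ + z.1.1 * u : ℝ) * Complex.I) * f (u + z.1.2 * ℏ)
  have hφ : Continuous φ := by
    have := f.continuous
    fun_prop
  obtain ⟨C, hC⟩ : ∃ C, ∀ x, ‖f x‖ ≤ C :=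
    ⟨_, f.toBoundedContinuousFunction.norm_coe_le_norm⟩
  have hφC : ∀ z, ‖φ z‖ ≤ C := fun z => by
    simpa only [φ, norm_mul, Complex.norm_exp_ofReal_mul_I, one_mul] using hC _
  have key := integral_integral_sub_mul_eq_shear a.integrable b.integrable hφ hφC
  simp only [hOp]
  convert key using 3 with p p
  · rw [show p = (p.1, p.2) from rfl, hconv, mul_assoc, ← integral_mul_const]
    refine integral_congr_ae (.of_forall fun q => ?_)
    simp only [φ, ← mul_assoc]
    rw [mul_assoc _ (Complex.exp _) (Complex.exp _), ← Complex.exp_add]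
    congr 3
    push_cast
    ring
  · rw [← integral_const_mul]
    refine integral_congr_ae (.of_forall fun q => ?_)
    have hexp : Complex.exp ((((p + q).2 - q.2) * q.1 * ℏ + (p + q).1 * u : ℝ) * Complex.I) =
        Complex.exp (Complex.I * p.1 * u) *
          Complex.exp (Complex.I * q.1 * ((u + p.2 * ℏ : ℝ) : ℂ)) := by
      rw [← Complex.exp_add]
      congr 1
      simp only [Prod.fst_add, Prod.snd_add]
      push_cast
      ring
    have harg : u + (p + q).2 * ℏ = u + p.2 * ℏ + q.2 * ℏ := by
      simp only [Prod.snd_add]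
      ring
    simp only [φ]
    rw [hexp, harg]
    ring
end

section
/- Let ℏ ∈ ℝ with ℏ ≠ 0, and let a ∈ 𝓢(ℝ², ℂ). If for every f ∈ 𝓢(ℝ, ℂ) and every u ∈ ℝ one has ∫_{ℝ²} a(t, s)·e^{itu}·f(u + sℏ) dt ds = 0, then a = 0. -/
open MeasureTheory

open scoped FourierTransform in
/-- A continuous integrable function on `ℝ` whose Fourier transform vanishes is zero. -/
theorem eq_zero_of_integral_exp_mul_eq_zero {φ : ℝ → ℂ} (hc : Continuous φ)
    (hi : Integrable φ)
    (h : ∀ u : ℝ, ∫ t : ℝ, Complex.exp (Complex.I * (t : ℂ) * (u : ℂ)) * φ t = 0) :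
    φ = 0 := by
  have hF : 𝓕 φ = 0 := by
    ext w
    rw [Real.fourier_real_eq_integral_exp_smul, Pi.zero_apply, ← h (-2 * Real.pi * w)]
    refine integral_congr_ae (.of_forall fun t ↦ ?_)
    simp only [smul_eq_mul]
    congr 2
    push_cast
    ring
  have hinv := hc.fourierInv_fourier_eq hi (by rw [hF]; exact integrable_zero _ _ _)
  rw [← hinv, hF]
  ext x
  simp [Real.fourierInv_eq]

/-- For `ℏ ≠ 0`, the Weyl-type operator associated to a Schwartz
function `a` on `ℝ²` is injective in `a`: if `∫ a(t,s) e^{itu} f(u+sℏ) dt ds = 0`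
for all Schwartz `f` and all `u`, then `a = 0`. -/
theorem stmt10 (ℏ : ℝ) (hℏ : ℏ ≠ 0) (a : SchwartzMap (ℝ × ℝ) ℂ)
    (h : ∀ (f : SchwartzMap ℝ ℂ) (u : ℝ),
      (∫ p : ℝ × ℝ, a p * Complex.exp (Complex.I * (p.1 : ℂ) * (u : ℂ)) *
        f (u + p.2 * ℏ)) = 0) :
    a = 0 := by
  have ha : Integrable a (volume : Measure (ℝ × ℝ)) := a.integrable
  obtain ⟨C, hC⟩ : ∃ C, ∀ p, ‖a p‖ ≤ C := ⟨_, a.toBoundedContinuousFunction.norm_coe_le_norm⟩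
  have key (g : ℝ → ℝ) (hg : ContDiff ℝ (⊤ : ℕ∞) g) (hs : HasCompactSupport g) :
      (fun t : ℝ ↦ ∫ s : ℝ, g s • a (t, s)) = 0 := by
    have hgi : Integrable g := hg.continuous.integrable_of_hasCompactSupport hs
    obtain ⟨K, hK⟩ := hg.continuous.bounded_above_of_compact_support hs
    have hprod : Integrable (fun p : ℝ × ℝ ↦ g p.2 • a p) (volume.prod volume) :=
      ha.bdd_smul K (hg.continuous.comp continuous_snd).aestronglyMeasurable
        (.of_forall fun p ↦ hK p.2)
    apply eq_zero_of_integral_exp_mul_eq_zero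
    · refine continuous_of_dominated (bound := fun s ↦ ‖g s‖ * C) (fun t ↦ ?_) (fun t ↦ ?_)
        (hgi.norm.mul_const C) ?_
      · exact (hg.continuous.smul (a.continuous.comp (by fun_prop))).aestronglyMeasurable
      · refine .of_forall fun s ↦ ?_
        rw [norm_smul]
        gcongr
        exact hC _
      · exact .of_forall fun s ↦ (a.continuous.comp (by fun_prop)).const_smul (g s)
    · exact hprod.integral_prod_left
    · intro u
      let G : ℝ → ℂ := fun x ↦ (g ((x - u) * ℏ⁻¹) : ℂ)
      have hGc : HasCompactSupport G := by
        have h1 : HasCompactSupport (fun x ↦ g ((x - u) * ℏ⁻¹)) :=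
          hs.comp_homeomorph
            ((Homeomorph.subRight u).trans (Homeomorph.mulRight₀ ℏ⁻¹ (inv_ne_zero hℏ)))
        exact h1.comp_left (g := ((↑) : ℝ → ℂ)) Complex.ofReal_zero
      have hGd : ContDiff ℝ (⊤ : ℕ∞) G :=
        Complex.ofRealCLM.contDiff.comp (hg.comp (by fun_prop))
      have hzero := h (hGc.toSchwartzMap hGd) u
      have hint : Integrable (fun p : ℝ × ℝ ↦
          Complex.exp (Complex.I * (p.1 : ℂ) * (u : ℂ)) * g p.2 • a p)
          (volume.prod volume) := by
        refine hprod.bdd_mul (c := 1) (Continuous.aestronglyMeasurable (by fun_prop))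
          (.of_forall fun p ↦ ?_)
        rw [mul_assoc, mul_comm, ← Complex.ofReal_mul, Complex.norm_exp_ofReal_mul_I]
      rw [← hzero, Measure.volume_eq_prod]
      simp_rw [← integral_const_mul]
      rw [← integral_prod _ hint]
      refine integral_congr_ae (.of_forall fun p ↦ ?_)
      have : (u + p.2 * ℏ - u) * ℏ⁻¹ = p.2 := by field_simp; ring
      simp only [HasCompactSupport.toSchwartzMap_toFun, G, this, Complex.real_smul]
      ring
  ext ⟨t, s⟩
  have hcont : Continuous fun s : ℝ ↦ a (t, s) := a.continuous.comp (by fun_prop)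
  have hae : ∀ᵐ s : ℝ, a (t, s) = 0 :=
    ae_eq_zero_of_integral_contDiff_smul_eq_zero hcont.locallyIntegrable
      fun g hg hs ↦ congrFun (key g hg hs) t
  exact congrFun (Continuous.ae_eq_iff_eq volume hcont continuous_const |>.1 hae) s
end
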